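/- Let A be a complex n×n matrix such that A A† is equal to its own transpose (i.e., A A† is a real symmetric matrix). Then A admits a decomposition A = O' D O'' Φ O, where O', O'', O are real orthogonal n×n matrices, D is a real diagonal matrix, and Φ is a diagonal unitary matrix with entries of the form e^{iφ_j}. -/

import Mathlib

open scoped Matrix

open Module.End in
/-- Commuting real symmetric matrices are simultaneously orthogonally diagonalizable. -/
lemma simul_diag {n : ℕ} (X Y : Matrix (Fin n) (Fin n) ℝ) (hX : Xᵀ = X) (hY : Yᵀ = Y)
    (hXY : X * Y = Y * X) :
    ∃ (Q : Matrix (Fin n) (Fin n) ℝ) (x y : Fin n → ℝ), Qᵀ * Q = 1 ∧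
      X * Q = Q * Matrix.diagonal x ∧ Y * Q = Q * Matrix.diagonal y := by
  classical
  let S := Matrix.toEuclideanLin X
  let T := Matrix.toEuclideanLin Y
  have hS : S.IsSymmetric := Matrix.isSymmetric_toEuclideanLin_iff.mpr (by simpa [Matrix.IsHermitian] using hX)
  have hT : T.IsSymmetric := Matrix.isSymmetric_toEuclideanLin_iff.mpr (by simpa [Matrix.IsHermitian] using hY)
  have hST : Commute S T := by
    refine LinearMap.ext fun v => ?_
    simp [S, T, Matrix.toLpLin_apply, Matrix.mulVec_mulVec, hXY]
  let V : Eigenvalues S × Eigenvalues T → Submodule ℝ (EuclideanSpace ℝ (Fin n)) :=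
    fun i => eigenspace S (i.1 : ℝ) ⊓ eigenspace T (i.2 : ℝ)
  have hV' : OrthogonalFamily ℝ (fun i => V i) fun i => (V i).subtypeₗᵢ := by
    have := (LinearMap.IsSymmetric.orthogonalFamily_eigenspace_inf_eigenspace hS hT).comp
      (γ := Eigenvalues S × Eigenvalues T) (f := fun i => ((i.2 : ℝ), (i.1 : ℝ))) (by
        rintro ⟨a, b⟩ ⟨c, d⟩ h
        simp only [Prod.mk.injEq] at h
        exact Prod.ext (Subtype.ext h.2) (Subtype.ext h.1))
    exact this
  have htop : iSup V = ⊤ := by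
    rw [eq_top_iff, ← LinearMap.IsSymmetric.iSup_iSup_eigenspace_inf_eigenspace_eq_top_of_commute hS hT hST]
    refine iSup_le fun α => iSup_le fun γ => ?_
    by_cases h1 : HasEigenvalue S α
    · by_cases h2 : HasEigenvalue T γ
      · exact le_iSup V (⟨α, h1⟩, ⟨γ, h2⟩)
      · have : eigenspace T γ = ⊥ := by
          by_contra h; exact h2 h
        simp [this]
    · have : eigenspace S α = ⊥ := by
        by_contra h; exact h1 h
      simp [this]
  have hV : DirectSum.IsInternal V := by
    rw [hV'.isInternal_iff, htop, Submodule.top_orthogonal_eq_bot]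
  let b := hV.subordinateOrthonormalBasis (n := n) (by simp) hV'
  let k := fun a => hV.subordinateOrthonormalBasisIndex (n := n) (by simp) a hV'
  have hb : ∀ a, b a ∈ V (k a) := fun a =>
    hV.subordinateOrthonormalBasis_subordinate (by simp) a hV'
  refine ⟨Matrix.of fun i j => b j i, fun a => ((k a).1 : ℝ), fun a => ((k a).2 : ℝ), ?_, ?_, ?_⟩
  · ext i j
    have := orthonormal_iff_ite.mp b.orthonormal i j
    simp [Matrix.mul_apply, PiLp.inner_apply, Matrix.one_apply] at this ⊢
    rw [← this]
    exact Finset.sum_congr rfl fun _ _ => mul_comm _ _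
  · ext i j
    have := mem_eigenspace_iff.mp (hb j).1
    have := congrArg (fun v => v i) this
    simp [S, Matrix.toLpLin_apply, Matrix.mulVec, dotProduct] at this
    simp [Matrix.mul_apply, Matrix.diagonal_apply, this, mul_comm]
    exact Or.inl rfl
  · ext i j
    have := mem_eigenspace_iff.mp (hb j).2
    have := congrArg (fun v => v i) this
    simp [T, Matrix.toLpLin_apply, Matrix.mulVec, dotProduct] at this
    simp [Matrix.mul_apply, Matrix.diagonal_apply, this, mul_comm]
    exact Or.inl rfl

/-- complexification of a real matrix -/
noncomputable abbrev cx {n : ℕ} (M : Matrix (Fin n) (Fin n) ℝ) : Matrix (Fin n) (Fin n) ℂ :=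
  M.map (fun a => (a : ℂ))

lemma cx_mul {n : ℕ} (M N : Matrix (Fin n) (Fin n) ℝ) : cx (M * N) = cx M * cx N := by
  ext i j; simp [Matrix.mul_apply]

lemma cx_one {n : ℕ} : cx (1 : Matrix (Fin n) (Fin n) ℝ) = 1 := by
  ext i j; simp [Matrix.one_apply]; split_ifs <;> simp

lemma cx_diag {n : ℕ} (d : Fin n → ℝ) :
    cx (Matrix.diagonal d) = Matrix.diagonal (fun j => (d j : ℂ)) := by
  ext i j; simp [Matrix.diagonal_apply]; split_ifs <;> simp

lemma cx_inj {n : ℕ} {M N : Matrix (Fin n) (Fin n) ℝ} (h : cx M = cx N) : M = N := by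
  ext i j; simpa using congrFun (congrFun h i) j

lemma cx_transpose {n : ℕ} (M : Matrix (Fin n) (Fin n) ℝ) : cx Mᵀ = (cx M)ᵀ := rfl

lemma cx_conj {n : ℕ} (M : Matrix (Fin n) (Fin n) ℝ) : (cx M)ᴴ = (cx M)ᵀ := by
  ext i j; simp

/-- A matrix fixed by conjugation is real. -/
lemma exists_real {n : ℕ} (M : Matrix (Fin n) (Fin n) ℂ) (h : Mᴴ = Mᵀ) : ∃ R, M = cx R := by
  refine ⟨M.map Complex.re, ?_⟩
  ext i j
  have := congrFun (congrFun h j) i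
  simp at this ⊢
  exact (Complex.conj_eq_iff_re.mp this).symm

/-- symmetric unitary matrices -/
lemma symm_unitary {n : ℕ} (W : Matrix (Fin n) (Fin n) ℂ) (hs : Wᵀ = W) (hu : Wᴴ * W = 1) :
    ∃ (Q : Matrix (Fin n) (Fin n) ℝ) (φ : Fin n → ℝ), Qᵀ * Q = 1 ∧
      W * cx Q = cx Q * Matrix.diagonal (fun j => Complex.exp (Complex.I * φ j) ^ 2) := by
  let X := W.map Complex.re
  let Y := W.map Complex.im
  have hW : W = cx X + Complex.I • cx Y := by
    ext i j; simp only [X, Y, Matrix.add_apply, Matrix.smul_apply, Matrix.map_apply, smul_eq_mul]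
    rw [mul_comm, Complex.re_add_im]
  have hX : Xᵀ = X := by
    ext i j; exact congrArg Complex.re (congrFun (congrFun hs i) j)
  have hY : Yᵀ = Y := by
    ext i j; exact congrArg Complex.im (congrFun (congrFun hs i) j)
  have hWc : Wᴴ = cx X - Complex.I • cx Y := by
    rw [hW, Matrix.conjTranspose_add, Matrix.conjTranspose_smul, cx_conj, cx_conj,
      ← cx_transpose, ← cx_transpose, hX, hY]
    simp [sub_eq_add_neg]
  have hXY : X * Y = Y * X := by
    have h := hu
    rw [hWc, hW] at h
    have h2 : cx (X * X + Y * Y) + Complex.I • cx (X * Y - Y * X) = 1 := by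
      rw [← h]
      ext i j
      simp only [sub_mul, mul_add, Matrix.smul_mul, Matrix.mul_smul, smul_smul, Complex.I_mul_I,
        ← cx_mul, Matrix.add_apply, Matrix.sub_apply, Matrix.smul_apply, Matrix.map_apply,
        smul_eq_mul, Complex.ofReal_add, Complex.ofReal_sub]
      ring
    ext i j
    have := congrArg Complex.im (congrFun (congrFun h2 i) j)
    have h1 : ((1 : Matrix (Fin n) (Fin n) ℂ) i j).im = 0 := by
      simp [Matrix.one_apply]; split_ifs <;> simp
    rw [h1] at this
    simp only [Matrix.add_apply, Matrix.sub_apply, Matrix.smul_apply, Matrix.map_apply,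
        smul_eq_mul, Complex.add_im, Complex.ofReal_im, Complex.I_mul_im, Complex.ofReal_re] at this
    linarith
  obtain ⟨Q, x, y, hQ, hQx, hQy⟩ := simul_diag X Y hX hY hXY
  let θ : Fin n → ℂ := fun j => x j + Complex.I * y j
  have hWQ : W * cx Q = cx Q * Matrix.diagonal θ := by
    rw [hW, add_mul, Matrix.smul_mul, ← cx_mul, ← cx_mul, hQx, hQy, cx_mul, cx_mul, cx_diag,
      cx_diag]
    ext i j
    simp [θ, Matrix.mul_diagonal]
    ring
  have hQc : (cx Q)ᴴ * cx Q = 1 := by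
    rw [cx_conj, ← cx_transpose, ← cx_mul, hQ, cx_one]
  have hθ : ∀ j, ‖θ j‖ = 1 := by
    intro j
    have h : (W * cx Q)ᴴ * (W * cx Q) = 1 := by
      rw [Matrix.conjTranspose_mul, mul_assoc, ← mul_assoc Wᴴ, hu, one_mul, hQc]
    rw [hWQ, Matrix.conjTranspose_mul, mul_assoc, ← mul_assoc _ (cx Q), hQc, one_mul,
      Matrix.diagonal_conjTranspose, Matrix.diagonal_mul_diagonal] at h
    have := congrFun (congrFun h j) j
    simp at this
    rw [Complex.conj_mul'] at this
    have h3 : ‖θ j‖ ^ 2 = 1 := by exact_mod_cast this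
    nlinarith [norm_nonneg (θ j)]
  refine ⟨Q, fun j => (θ j).arg / 2, hQ, ?_⟩
  rw [hWQ]
  congr 2
  funext j
  rw [← Complex.exp_nat_mul]
  conv_lhs => rw [← Complex.norm_mul_exp_arg_mul_I (θ j), hθ]
  simp
  congr 1
  ring

/-- Every unitary matrix is `P Φ O`. -/
lemma unitary_decomp {n : ℕ} (V : Matrix (Fin n) (Fin n) ℂ) (hV : Vᴴ * V = 1) :
    ∃ (P Q : Matrix (Fin n) (Fin n) ℝ) (φ : Fin n → ℝ), Pᵀ * P = 1 ∧ Qᵀ * Q = 1 ∧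
      V = cx P * Matrix.diagonal (fun j => Complex.exp (Complex.I * φ j)) * cx Qᵀ := by
  have hV' : V * Vᴴ = 1 := mul_eq_one_comm.mp hV
  have hVb : (Vᵀ)ᴴ * Vᵀ = 1 := by
    have := congrArg Matrix.transpose hV'
    rw [Matrix.transpose_mul, Matrix.transpose_one] at this
    exact this
  obtain ⟨Q, φ, hQ, hW⟩ := symm_unitary (Vᵀ * V) (by simp) (by
    rw [Matrix.conjTranspose_mul, mul_assoc, ← mul_assoc _ Vᵀ, hVb, one_mul, hV])
  have hQ' : cx Q * cx Qᵀ = 1 := by rw [← cx_mul, mul_eq_one_comm.mp hQ, cx_one]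
  have hQ'' : cx Qᵀ * cx Q = 1 := by rw [← cx_mul, hQ, cx_one]
  let F : Matrix (Fin n) (Fin n) ℂ := Matrix.diagonal (fun j => Complex.exp (Complex.I * φ j))
  let G : Matrix (Fin n) (Fin n) ℂ := Matrix.diagonal (fun j => Complex.exp (-(Complex.I * φ j)))
  have hGF : G * F = 1 := by
    simp [G, F, Matrix.diagonal_mul_diagonal, ← Complex.exp_add]
  have hFG : F * G = 1 := mul_eq_one_comm.mp hGF
  have hFF : Matrix.diagonal (fun j => Complex.exp (Complex.I * φ j) ^ 2) = F * F := by
    simp [F, Matrix.diagonal_mul_diagonal, sq]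
  have hGt : Gᵀ = G := by simp [G]
  have hGc : Gᴴ = F := by
    simp only [G, F, Matrix.diagonal_conjTranspose]
    congr 1
    funext j
    simp [← Complex.exp_conj]
  rw [hFF] at hW
  let Z := V * cx Q * G
  have hZt : Zᵀ * Z = 1 := by
    calc Zᵀ * Z = G * (cx Qᵀ * (Vᵀ * V * cx Q)) * G := by
          simp only [Z, Matrix.transpose_mul, hGt, cx_transpose, mul_assoc]
      _ = G * F * (F * G) := by rw [hW, ← mul_assoc (cx Qᵀ), hQ'', one_mul]; simp only [mul_assoc]
      _ = 1 := by rw [hGF, hFG, one_mul]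
  have hZc : Zᴴ * Z = 1 := by
    calc Zᴴ * Z = F * (cx Qᵀ * ((Vᴴ * V) * cx Q)) * G := by
          simp only [Z, Matrix.conjTranspose_mul, hGc, cx_conj, cx_transpose, mul_assoc]
      _ = 1 := by rw [hV, one_mul, hQ'', mul_one, hFG]
  have hZ : Zᴴ = Zᵀ := left_inv_eq_right_inv hZc (mul_eq_one_comm.mp hZt)
  obtain ⟨P, hP⟩ := exists_real Z hZ
  refine ⟨P, Q, φ, ?_, hQ, ?_⟩
  · apply cx_inj
    rw [cx_mul, cx_transpose, ← hP, hZt, cx_one]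
  · change V = cx P * F * cx Qᵀ
    rw [← hP]
    simp only [Z]
    rw [mul_assoc _ G, hGF, mul_one, mul_assoc, hQ', mul_one]

/-- A matrix with orthogonal rows is diagonal times unitary. -/
lemma diag_unitary {n : ℕ} (B : Matrix (Fin n) (Fin n) ℂ) (l : Fin n → ℂ)
    (h : B * Bᴴ = Matrix.diagonal l) :
    ∃ (d : Fin n → ℝ) (V : Matrix (Fin n) (Fin n) ℂ), Vᴴ * V = 1 ∧
      B = Matrix.diagonal (fun j => (d j : ℂ)) * V := by
  let r : Fin n → EuclideanSpace ℂ (Fin n) := fun i => WithLp.toLp 2 (B i)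
  have hr : ∀ i j, i ≠ j → inner ℂ (r i) (r j) = 0 := by
    intro i j hij
    have := congrFun (congrFun h j) i
    rw [Matrix.diagonal_apply_ne _ hij.symm] at this
    rw [← this]
    simp [r, PiLp.inner_apply, Matrix.mul_apply]
  let v : Fin n → EuclideanSpace ℂ (Fin n) := fun i => ((‖r i‖⁻¹ : ℝ) : ℂ) • r i
  let s : Set (Fin n) := {i | r i ≠ 0}
  have hv : Orthonormal ℂ (s.domRestrict v) := by
    constructor
    · rintro ⟨i, hi⟩
      have : ‖r i‖ ≠ 0 := norm_ne_zero_iff.mpr hi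
      simp [v, norm_smul, this]
    · rintro ⟨i, hi⟩ ⟨j, hj⟩ hij
      have : i ≠ j := fun h => hij (Subtype.ext h)
      simp [v, inner_smul_left, inner_smul_right, hr i j this]
  obtain ⟨b, hb⟩ := hv.exists_orthonormalBasis_extension_of_card_eq (by simp)
  refine ⟨fun i => ‖r i‖, Matrix.of fun i j => b i j, ?_, ?_⟩
  · rw [mul_eq_one_comm]
    ext i j
    have := orthonormal_iff_ite.mp b.orthonormal j i
    simp [Matrix.mul_apply, PiLp.inner_apply, Matrix.one_apply] at this ⊢
    rw [this]
    simp [eq_comm]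
  · ext i j
    rw [Matrix.diagonal_mul]
    by_cases hi : r i = 0
    · have : B i j = 0 := by simpa [r] using congrArg (fun w => w j) hi
      simp [hi, this]
    · have hn : (‖r i‖ : ℂ) ≠ 0 := by exact_mod_cast norm_ne_zero_iff.mpr hi
      rw [Matrix.of_apply, hb i hi]
      simp only [v, PiLp.smul_apply, smul_eq_mul, Complex.ofReal_inv]
      rw [mul_inv_cancel_left₀ hn]

/-- If `A Aᴴ` equals its own transpose, then `A = O' D O'' Φ O` with
`O', O'', O` real orthogonal, `D` real diagonal, and `Φ` diagonal unitary with
entries `e^{iφ_j}`. -/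
theorem matrix_decomposition {n : ℕ} (A : Matrix (Fin n) (Fin n) ℂ)
    (hA : (A * Aᴴ)ᵀ = A * Aᴴ) :
    ∃ (O' O'' O : Matrix (Fin n) (Fin n) ℝ) (d : Fin n → ℝ) (φ : Fin n → ℝ),
      O' ∈ Matrix.orthogonalGroup (Fin n) ℝ ∧
      O'' ∈ Matrix.orthogonalGroup (Fin n) ℝ ∧
      O ∈ Matrix.orthogonalGroup (Fin n) ℝ ∧
      A = O'.map (fun a => (a : ℂ)) * Matrix.diagonal (fun j => ((d j : ℝ) : ℂ)) *
          O''.map (fun a => (a : ℂ)) * Matrix.diagonal (fun j => Complex.exp (Complex.I * φ j)) *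
          O.map (fun a => (a : ℂ)) := by
  obtain ⟨M, hM⟩ := exists_real (A * Aᴴ) (by rw [hA]; simp)
  have hMt : Mᵀ = M := cx_inj (by rw [cx_transpose, ← hM, hA])
  obtain ⟨R, x, -, hR, hRx, -⟩ := simul_diag M M hMt hMt rfl
  have hR' : cx R * cx Rᵀ = 1 := by rw [← cx_mul, mul_eq_one_comm.mp hR, cx_one]
  have hB : (cx Rᵀ * A) * (cx Rᵀ * A)ᴴ = Matrix.diagonal (fun j => (x j : ℂ)) := by
    calc (cx Rᵀ * A) * (cx Rᵀ * A)ᴴ = cx Rᵀ * ((A * Aᴴ) * cx R) := by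
          rw [Matrix.conjTranspose_mul, cx_conj, ← cx_transpose, Matrix.transpose_transpose]
          simp only [mul_assoc]
      _ = _ := by
          rw [hM, ← cx_mul, hRx, ← cx_mul, ← mul_assoc, hR, one_mul, cx_diag]
  obtain ⟨d, V, hV, hBV⟩ := diag_unitary _ _ hB
  obtain ⟨P, Q, φ, hP, hQ, hPQ⟩ := unitary_decomp V hV
  refine ⟨R, P, Qᵀ, d, φ, ?_, ?_, ?_, ?_⟩
  · rw [Matrix.mem_orthogonalGroup_iff']; exact hR
  · rw [Matrix.mem_orthogonalGroup_iff']; exact hP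
  · rw [Matrix.mem_orthogonalGroup_iff]; exact hQ
  · calc A = cx R * (cx Rᵀ * A) := by rw [← mul_assoc, hR', one_mul]
      _ = _ := by rw [hBV, hPQ]; simp only [mul_assoc]
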